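/- arXiv:math/0502409 — 2 statements merged into one kernel-verified Lean document; each statement's English description precedes it below -/
import Mathlib

section
/- For every k ≥ 0 there is an isomorphism of Lie algebras 𝔉 / (ker τ[t] + Σ_{r>k} F^r(𝔞)) ≅ 𝔞[t] / (𝔞 ⊗ t^{k+1}ℂ[t]), induced by the extension of τ[t] to 𝔉 = 𝔞 ⊕ F(𝔞). -/
open TensorAlgebra TensorProduct Polynomial

noncomputable section

/-- The graded pieces `F^r(a)` of the free Lie algebra on the vector space `a`,
realized inside the tensor algebra `T(a)`:  `F¹(a) = ι(a)` and `F^{r+1}(a)` is spanned by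
the commutators `ι(x) * y - y * ι(x)` with `x ∈ a`, `y ∈ F^r(a)`. -/
def Fr (a : Type*) [LieRing a] [LieAlgebra ℂ a] : ℕ → Submodule ℂ (TensorAlgebra ℂ a)
  | 0 => ⊥
  | 1 => LinearMap.range (TensorAlgebra.ι ℂ (M := a))
  | (r + 2) => Submodule.span ℂ
      {u | ∃ (x : a) (y : TensorAlgebra ℂ a), y ∈ Fr a (r + 1) ∧
        u = TensorAlgebra.ι ℂ x * y - y * TensorAlgebra.ι ℂ x}

/-- The free Lie algebra `F(a) = ⊕_{r>0} F^r(a)` on the vector space `a`,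
as a subspace of the tensor algebra. -/
def FLie (a : Type*) [LieRing a] [LieAlgebra ℂ a] : Submodule ℂ (TensorAlgebra ℂ a) :=
  ⨆ r, Fr a r

/-- `IsTau a τ` says that the linear map `τ` is (a linear extension to `T(a)` of) the canonical
Lie algebra homomorphism `τ : F(a) → a`: it is the identity on `F¹(a) = a` and takes the
commutator bracket of `T(a)` (restricted to `F(a)`) to the bracket of `a`. -/
def IsTau (a : Type*) [LieRing a] [LieAlgebra ℂ a] (τ : TensorAlgebra ℂ a →ₗ[ℂ] a) : Prop :=
  (∀ x : a, τ (TensorAlgebra.ι ℂ x) = x) ∧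
  ∀ r s : ℕ, ∀ u ∈ Fr a r, ∀ v ∈ Fr a s, τ (u * v - v * u) = ⁅τ u, τ v⁆

/-- The current algebra `a[t] = a ⊗ ℂ[t]`, with bracket `⁅x ⊗ f, y ⊗ g⁆ = ⁅x, y⁆ ⊗ fg`. -/
abbrev Cur (a : Type*) [LieRing a] [LieAlgebra ℂ a] : Type _ := Polynomial ℂ ⊗[ℂ] a

/-- `IsTauT a τ τt` says that the linear map `τt` is (a linear extension to `T(a)` of) the map
`τ[t] : F(a) → a[t]` given by `τ[t](𝐱) = τ(𝐱) ⊗ t^r` for `𝐱 ∈ F^r(a)`. -/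
def IsTauT (a : Type*) [LieRing a] [LieAlgebra ℂ a] (τ : TensorAlgebra ℂ a →ₗ[ℂ] a)
    (τt : TensorAlgebra ℂ a →ₗ[ℂ] Cur a) : Prop :=
  ∀ r : ℕ, ∀ u ∈ Fr a r, τt u = ((X : ℂ[X]) ^ r) ⊗ₜ[ℂ] (τ u)

end

noncomputable section

/-- `IsAdT a adT` says that `adT` is the diagonal adjoint action of `a` on its tensor algebra,
i.e. `adT x` is the derivation of `T(a)` with `adT x (ι y) = ι ⁅x, y⁆`. -/
def IsAdT (a : Type*) [LieRing a] [LieAlgebra ℂ a]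
    (adT : a →ₗ[ℂ] Module.End ℂ (TensorAlgebra ℂ a)) : Prop :=
  (∀ x : a, adT x 1 = 0) ∧
  (∀ x y : a, adT x (TensorAlgebra.ι ℂ y) = TensorAlgebra.ι ℂ ⁅x, y⁆) ∧
  (∀ (x : a) (u v : TensorAlgebra ℂ a), adT x (u * v) = adT x u * v + u * adT x v)

/-- The bracket of the semidirect product `𝔉 = a ⊕ F(a)`, written on the ambient space
`a × T(a)`:  `⁅(x, 𝐲), (x', 𝐲')⁆ = (⁅x,x'⁆, adT x 𝐲' - adT x' 𝐲 + (𝐲𝐲' - 𝐲'𝐲))`. -/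
def Fbr (a : Type*) [LieRing a] [LieAlgebra ℂ a]
    (adT : a →ₗ[ℂ] Module.End ℂ (TensorAlgebra ℂ a))
    (p q : a × TensorAlgebra ℂ a) : a × TensorAlgebra ℂ a :=
  (⁅p.1, q.1⁆, adT p.1 q.2 - adT q.1 p.2 + (p.2 * q.2 - q.2 * p.2))

/-- The extension of `τ[t]` to `𝔉 = a ⊕ F(a)`, sending `(x, 𝐲)` to `x ⊗ 1 + τ[t](𝐲)`. -/
def PhiF (a : Type*) [LieRing a] [LieAlgebra ℂ a]
    (τt : TensorAlgebra ℂ a →ₗ[ℂ] Cur a) (p : a × TensorAlgebra ℂ a) : Cur a :=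
  (1 : ℂ[X]) ⊗ₜ[ℂ] p.1 + τt p.2

end

/-- The coefficient of `t ^ n` in the current algebra. -/
noncomputable def Cur.coeff (a : Type*) [LieRing a] [LieAlgebra ℂ a] (n : ℕ) :
    Cur a →ₗ[ℂ] a :=
  TensorProduct.lid ℂ a ∘ₗ (Polynomial.lcoeff ℂ n).rTensor a

@[simp]
theorem Cur.coeff_tmul {a : Type*} [LieRing a] [LieAlgebra ℂ a] (n : ℕ) (f : ℂ[X]) (x : a) :
    Cur.coeff a n (f ⊗ₜ[ℂ] x) = f.coeff n • x := by
  simp [Cur.coeff]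

theorem Fr_le_FLie (a : Type*) [LieRing a] [LieAlgebra ℂ a] (r : ℕ) : Fr a r ≤ FLie a :=
  le_iSup (Fr a) r

/-- For perfect `a`, the canonical map `τ` is surjective on each graded piece of `F(a)`. -/
theorem IsTau.map_Fr_succ {a : Type*} [LieRing a] [LieAlgebra ℂ a]
    (h : Submodule.span ℂ {z : a | ∃ x y : a, z = ⁅x, y⁆} = ⊤)
    {τ : TensorAlgebra ℂ a →ₗ[ℂ] a} (hτ : IsTau a τ) (r : ℕ) :
    (Fr a (r + 1)).map τ = ⊤ := by
  induction r with
  | zero => exact eq_top_iff.2 fun x _ => ⟨ι ℂ x, ⟨x, rfl⟩, hτ.1 x⟩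
  | succ r ih =>
    rw [eq_top_iff, ← h, Submodule.span_le]
    rintro _ ⟨x, y, rfl⟩
    obtain ⟨v, hv, rfl⟩ : y ∈ (Fr a (r + 1)).map τ := ih ▸ Submodule.mem_top
    refine ⟨ι ℂ x * v - v * ι ℂ x, Submodule.subset_span ⟨x, v, hv, rfl⟩, ?_⟩
    rw [hτ.2 1 (r + 1) _ ⟨x, rfl⟩ v hv, hτ.1]

theorem PhiF_add {a : Type*} [LieRing a] [LieAlgebra ℂ a] (τt : TensorAlgebra ℂ a →ₗ[ℂ] Cur a)
    (p q : a × TensorAlgebra ℂ a) : PhiF a τt (p + q) = PhiF a τt p + PhiF a τt q := by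
  simp only [PhiF, Prod.fst_add, Prod.snd_add, TensorProduct.tmul_add, map_add]
  abel

theorem exists_PhiF_eq {a : Type*} [LieRing a] [LieAlgebra ℂ a]
    (h : Submodule.span ℂ {z : a | ∃ x y : a, z = ⁅x, y⁆} = ⊤)
    {τ : TensorAlgebra ℂ a →ₗ[ℂ] a} (hτ : IsTau a τ)
    {τt : TensorAlgebra ℂ a →ₗ[ℂ] Cur a} (hτt : IsTauT a τ τt) (w : Cur a) :
    ∃ p : a × TensorAlgebra ℂ a, p.2 ∈ FLie a ∧ PhiF a τt p = w := by
  have add : ∀ v w : Cur a, (∃ p : a × TensorAlgebra ℂ a, p.2 ∈ FLie a ∧ PhiF a τt p = v) →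
      (∃ p : a × TensorAlgebra ℂ a, p.2 ∈ FLie a ∧ PhiF a τt p = w) →
      ∃ p : a × TensorAlgebra ℂ a, p.2 ∈ FLie a ∧ PhiF a τt p = v + w := by
    rintro _ _ ⟨p, hp, rfl⟩ ⟨q, hq, rfl⟩
    exact ⟨p + q, add_mem hp hq, PhiF_add τt p q⟩
  induction w using TensorProduct.induction_on with
  | zero => exact ⟨0, zero_mem _, by simp [PhiF]⟩
  | add v w hv hw => exact add v w hv hw
  | tmul f x =>
    induction f using Polynomial.induction_on' with
    | add f g hf hg => rw [TensorProduct.add_tmul]; exact add _ _ hf hg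
    | monomial n c =>
      rw [← mul_one c, ← smul_eq_mul, ← Polynomial.smul_monomial, TensorProduct.smul_tmul,
        Polynomial.monomial_one_right_eq_X_pow]
      cases n with
      | zero => exact ⟨(c • x, 0), zero_mem _, by simp [PhiF]⟩
      | succ n =>
        obtain ⟨y, hy, hyx⟩ : c • x ∈ (Fr a (n + 1)).map τ :=
          hτ.map_Fr_succ h n ▸ Submodule.mem_top
        exact ⟨(0, y), Fr_le_FLie a _ hy, by simp [PhiF, hτt _ y hy, hyx]⟩

/-- For every `k ≥ 0`, the extension of `τ[t]` to `𝔉 = a ⊕ F(a)` induces an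
isomorphism of Lie algebras `𝔉 / (ker τ[t] + Σ_{r>k} F^r(a)) ≅ a[t] / (a ⊗ t^{k+1}ℂ[t])`:
composed with the projection onto `a[t] / (a ⊗ t^{k+1}ℂ[t])` it is surjective, and an element
of `𝔉` is sent into `a ⊗ t^{k+1}ℂ[t]` exactly when it lies in `ker τ[t] + Σ_{r>k} F^r(a)`. -/
theorem statement3 (a : Type*) [LieRing a] [LieAlgebra ℂ a]
    (h𝔞 : Submodule.span ℂ {z : a | ∃ x y : a, z = ⁅x, y⁆} = ⊤)
    (τ : TensorAlgebra ℂ a →ₗ[ℂ] a) (hτ : IsTau a τ)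
    (τt : TensorAlgebra ℂ a →ₗ[ℂ] Cur a) (hτt : IsTauT a τ τt)
    (adT : a →ₗ[ℂ] Module.End ℂ (TensorAlgebra ℂ a)) (hadT : IsAdT a adT)
    (k : ℕ)
    -- `J` is the ideal `a ⊗ t^{k+1}ℂ[t]` of the current algebra
    (J : Submodule ℂ (Cur a))
    (hJ : J = Submodule.span ℂ {w : Cur a | ∃ (s : ℕ) (x : a), k < s ∧
      w = ((X : ℂ[X]) ^ s) ⊗ₜ[ℂ] x}) :
    (∀ p : a × TensorAlgebra ℂ a, p.2 ∈ FLie a →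
      (PhiF a τt p ∈ J ↔ p.1 = 0 ∧
        p.2 ∈ (FLie a ⊓ LinearMap.ker τt) ⊔ (⨆ r, ⨆ _ : k < r, Fr a r))) ∧
    (∀ w : Cur a, ∃ p : a × TensorAlgebra ℂ a, p.2 ∈ FLie a ∧ PhiF a τt p = w) := by
  have coeff_J : ∀ n ≤ k, ∀ w ∈ J, Cur.coeff a n w = 0 := by
    intro n hn w hw
    suffices J ≤ LinearMap.ker (Cur.coeff a n) from this hw
    rw [hJ, Submodule.span_le]
    rintro _ ⟨s, x, hs, rfl⟩
    simp [Polynomial.coeff_X_pow, (hn.trans_lt hs).ne]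
  refine ⟨fun p hp => ⟨fun hpJ => ?_, ?_⟩, exists_PhiF_eq h𝔞 hτ hτt⟩
  · obtain ⟨x, y⟩ := p
    obtain ⟨f, hf, hfy⟩ := (Submodule.mem_iSup_iff_exists_finsupp _ _).1 hp
    change f.sum (fun _ u => u) = y at hfy
    have hτf : τt y = ∑ r ∈ f.support, ((X : ℂ[X]) ^ r) ⊗ₜ[ℂ] τ (f r) := by
      rw [← hfy, Finsupp.sum, map_sum]
      exact Finset.sum_congr rfl fun r _ => hτt r _ (hf r)
    have hτ0 : τ (f 0) = 0 := by
      rw [(Submodule.mem_bot ℂ).1 (hf 0), map_zero]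
    have coeff_y : ∀ n, Cur.coeff a n (τt y) = τ (f n) := by
      intro n
      rw [hτf, map_sum, Finset.sum_eq_single n]
      · simp
      · intro r _ hrn
        simp [Polynomial.coeff_X_pow, hrn.symm]
      · intro hn
        simp [Finsupp.notMem_support_iff.1 hn]
    have hx : x = 0 := by
      simpa [PhiF, coeff_y, hτ0] using coeff_J 0 k.zero_le _ hpJ
    refine ⟨hx, ?_⟩
    have hker : ∀ r ≤ k, τ (f r) = 0 := by
      intro r hr
      simpa [PhiF, hx, coeff_y] using coeff_J r hr _ hpJ
    change y ∈ _
    rw [← hfy]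
    refine Submodule.sum_mem _ fun r _ => ?_
    rcases le_or_gt r k with hr | hr
    · refine Submodule.mem_sup_left ⟨Fr_le_FLie a r (hf r), ?_⟩
      simp [hτt r _ (hf r), hker r hr]
    · exact Submodule.mem_sup_right (Submodule.mem_iSup_of_mem r
        (Submodule.mem_iSup_of_mem hr (hf r)))
  · rintro ⟨hx, hy⟩
    have hle : (FLie a ⊓ LinearMap.ker τt) ⊔ (⨆ r, ⨆ _ : k < r, Fr a r) ≤ J.comap τt := by
      refine sup_le (fun u hu => ?_) (iSup₂_le fun r hr u hu => ?_)
      · simp [LinearMap.mem_ker.1 hu.2]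
      · rw [Submodule.mem_comap, hτt r u hu, hJ]
        exact Submodule.subset_span ⟨r, τ u, hr, rfl⟩
    simpa [PhiF, hx] using hle hy
end

section
/- Let ρ : 𝔞 → End(V) be a homomorphism of Lie algebras. Then there exists a Lie algebra homomorphism ρ[t] : 𝔞[t] → End(V) with ρ[t](x⊗1) = ρ(x) for all x ∈ 𝔞 if and only if there exists a linear map η : 𝔞 → End(V) which is a homomorphism of 𝔞-modules (where End(V) carries the 𝔞-module structure x·ψ = [ρ(x), ψ] induced by ρ) such that ker τ[t] ⊆ ker η_T, where η_T : T(𝔞) → End(V) is the algebra homomorphism extending η. Moreover, in this case the action is given by (x ⊗ t^r)·v = η^{⊙r}(𝐱)(v) for any 𝐱 ∈ F^r(𝔞) with τ_r(𝐱) = x. -/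
open TensorAlgebra TensorProduct Polynomial

/-- An additive predicate on `a[t]` holds everywhere if it holds on the tensors `t^r ⊗ x`. -/
theorem Cur.induction {a : Type*} [LieRing a] [LieAlgebra ℂ a] {P : Cur a → Prop}
    (hadd : ∀ z w, P z → P w → P (z + w))
    (hX : ∀ (r : ℕ) (x : a), P (((X : ℂ[X]) ^ r) ⊗ₜ[ℂ] x)) (z : Cur a) : P z := by
  induction z using TensorProduct.induction_on with
  | zero => simpa using hX 0 0
  | add z w hz hw => exact hadd z w hz hw
  | tmul p x =>
    induction p using Polynomial.induction_on' with
    | add p q hp hq => rw [TensorProduct.add_tmul]; exact hadd _ _ hp hq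
    | monomial n c =>
      rw [← mul_one c, ← smul_eq_mul, ← Polynomial.smul_monomial, TensorProduct.smul_tmul,
        Polynomial.monomial_one_right_eq_X_pow]
      exact hX n _

/-- A linear map out of `a[t]` is a Lie homomorphism as soon as it respects brackets of
the tensors `t^r ⊗ x`. -/
theorem Cur.map_lie {a : Type*} [LieRing a] [LieAlgebra ℂ a] {A : Type*} [Ring A] [Algebra ℂ A]
    (f : Cur a →ₗ[ℂ] A)
    (h : ∀ (r s : ℕ) (x y : a), f (((X : ℂ[X]) ^ (r + s)) ⊗ₜ[ℂ] ⁅x, y⁆) =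
      ⁅f (((X : ℂ[X]) ^ r) ⊗ₜ[ℂ] x), f (((X : ℂ[X]) ^ s) ⊗ₜ[ℂ] y)⁆) (z w : Cur a) :
    f ⁅z, w⁆ = ⁅f z, f w⁆ := by
  induction z using Cur.induction with
  | hadd z z' hz hz' =>
    rw [add_lie z z' w, map_add, hz, hz', map_add]
    simp only [Ring.lie_def]
    noncomm_ring
  | hX r x =>
    induction w using Cur.induction with
    | hadd w w' hw hw' =>
      rw [lie_add (((X : ℂ[X]) ^ r) ⊗ₜ[ℂ] x : Cur a) w w', map_add, hw, hw', map_add]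
      simp only [Ring.lie_def]
      noncomm_ring
    | hX s y => rw [LieAlgebra.ExtendScalars.bracket_tmul, ← pow_add, h]

/-- The linear map out of `a[t]` with prescribed restrictions to the pieces `t^r ⊗ a`. -/
theorem Cur.exists_linearMap {a : Type*} [LieRing a] [LieAlgebra ℂ a] {M : Type*}
    [AddCommGroup M] [Module ℂ M] (f : ℕ → a →ₗ[ℂ] M) :
    ∃ g : Cur a →ₗ[ℂ] M, ∀ (r : ℕ) (x : a), g (((X : ℂ[X]) ^ r) ⊗ₜ[ℂ] x) = f r x := by
  refine ⟨TensorProduct.lift ((Polynomial.basisMonomials ℂ).constr ℂ f), fun r x => ?_⟩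
  have h : (X : ℂ[X]) ^ r = Polynomial.basisMonomials ℂ r := by
    simp [Polynomial.monomial_one_right_eq_X_pow]
  rw [TensorProduct.lift.tmul, h, Module.Basis.constr_basis]

section FreeLie

variable {a : Type*} [LieRing a] [LieAlgebra ℂ a]

theorem commutator_ι_mem_Fr (x : a) {r : ℕ} {y : TensorAlgebra ℂ a} (hy : y ∈ Fr a (r + 1)) :
    TensorAlgebra.ι ℂ x * y - y * TensorAlgebra.ι ℂ x ∈ Fr a (r + 2) :=
  Submodule.subset_span ⟨x, y, hy, rfl⟩

theorem ι_mem_Fr_one (x : a) : TensorAlgebra.ι ℂ x ∈ Fr a 1 := ⟨x, rfl⟩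

/-- A subspace contains `F^{r+2}(a)` if it contains the commutators of `a` with `F^{r+1}(a)`. -/
theorem Fr_succ_succ_le {r : ℕ} {S : Submodule ℂ (TensorAlgebra ℂ a)}
    (h : ∀ (x : a), ∀ y ∈ Fr a (r + 1),
      TensorAlgebra.ι ℂ x * y - y * TensorAlgebra.ι ℂ x ∈ S) : Fr a (r + 2) ≤ S := by
  refine Submodule.span_le.2 ?_
  rintro _ ⟨x, y, hy, rfl⟩
  exact h x y hy

theorem commutator_mem_Fr (r s : ℕ) : ∀ u ∈ Fr a (r + 1), ∀ v ∈ Fr a (s + 1),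
    u * v - v * u ∈ Fr a (r + s + 2) := by
  induction r generalizing s with
  | zero =>
    rintro _ ⟨x, rfl⟩ v hv
    rw [zero_add]
    exact commutator_ι_mem_Fr x hv
  | succ r ih =>
    intro u hu v hv
    let D : TensorAlgebra ℂ a →ₗ[ℂ] TensorAlgebra ℂ a :=
      LinearMap.mulRight ℂ v - LinearMap.mulLeft ℂ v
    refine Fr_succ_succ_le (S := (Fr a (r + 1 + s + 2)).comap D) (fun x y hy => ?_) hu
    have h₁ := commutator_ι_mem_Fr x (ih s y hy v hv)
    have h₂ := ih (s + 1) y hy _ (commutator_ι_mem_Fr x hv)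
    rw [show r + (s + 1) + 2 = r + 1 + s + 2 by ring] at h₂
    rw [show r + s + 1 + 2 = r + 1 + s + 2 by ring] at h₁
    have h₃ := Submodule.sub_mem _ h₁ h₂
    rw [Submodule.mem_comap]
    convert h₃ using 1
    simp only [D, LinearMap.sub_apply, LinearMap.mulRight_apply, LinearMap.mulLeft_apply]
    noncomm_ring

/-- For a perfect Lie algebra, every `τ_r` with `r > 0` is surjective. -/
theorem IsTau.exists_mem_Fr (h𝔞 : Submodule.span ℂ {z : a | ∃ x y : a, z = ⁅x, y⁆} = ⊤)
    {τ : TensorAlgebra ℂ a →ₗ[ℂ] a} (hτ : IsTau a τ) (r : ℕ) :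
    ∀ x : a, ∃ u ∈ Fr a (r + 1), τ u = x := by
  induction r with
  | zero => exact fun x => ⟨_, ι_mem_Fr_one x, hτ.1 x⟩
  | succ r ih =>
    suffices h : (⊤ : Submodule ℂ a) ≤ (Fr a (r + 1 + 1)).map τ from
      fun x => h (Submodule.mem_top (x := x))
    rw [← h𝔞, Submodule.span_le]
    rintro _ ⟨x, y, rfl⟩
    obtain ⟨v, hv, rfl⟩ := ih y
    refine ⟨_, commutator_ι_mem_Fr x hv, ?_⟩
    rw [hτ.2 1 (r + 1) _ (ι_mem_Fr_one x) v hv, hτ.1]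

variable {M : Type*} [AddCommGroup M] [Module ℂ M]

/-- A linear map on `T(a)` whose kernel contains `ker τ_{r+1}` factors through `τ_{r+1}`. -/
theorem IsTau.exists_factor (h𝔞 : Submodule.span ℂ {z : a | ∃ x y : a, z = ⁅x, y⁆} = ⊤)
    {τ : TensorAlgebra ℂ a →ₗ[ℂ] a} (hτ : IsTau a τ) (r : ℕ) (φ : TensorAlgebra ℂ a →ₗ[ℂ] M)
    (hφ : ∀ u ∈ Fr a (r + 1), τ u = 0 → φ u = 0) :
    ∃ f : a →ₗ[ℂ] M, ∀ u ∈ Fr a (r + 1), f (τ u) = φ u := by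
  have hsurj : LinearMap.range (τ ∘ₗ (Fr a (r + 1)).subtype) = ⊤ := by
    refine LinearMap.range_eq_top.2 fun x => ?_
    obtain ⟨u, hu, hux⟩ := hτ.exists_mem_Fr h𝔞 r x
    exact ⟨⟨u, hu⟩, hux⟩
  obtain ⟨σ, hσ⟩ := LinearMap.exists_rightInverse_of_surjective _ hsurj
  refine ⟨φ ∘ₗ (Fr a (r + 1)).subtype ∘ₗ σ, fun u hu => ?_⟩
  refine sub_eq_zero.1 ?_
  have h := hφ ((σ (τ u) : TensorAlgebra ℂ a) - u) (Submodule.sub_mem _ (σ (τ u)).2 hu) ?_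
  · simpa using h
  · have h' := LinearMap.congr_fun hσ (τ u)
    rw [map_sub, sub_eq_zero]
    exact h'

variable {V : Type*} [AddCommGroup V] [Module ℂ V]

/-- A representation of `a[t]` restricts on `F(a)` to `η_T`, where `η` is its value on `t ⊗ a`. -/
theorem lift_eq_of_mem_Fr {τ : TensorAlgebra ℂ a →ₗ[ℂ] a} (hτ : IsTau a τ)
    (ρt : Cur a →ₗ[ℂ] Module.End ℂ V) (hρt : ∀ z w : Cur a, ρt ⁅z, w⁆ = ⁅ρt z, ρt w⁆)
    (η : a →ₗ[ℂ] Module.End ℂ V) (hη : ∀ x, η x = ρt ((X : ℂ[X]) ⊗ₜ[ℂ] x)) (r : ℕ) :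
    ∀ u ∈ Fr a r, TensorAlgebra.lift ℂ η u = ρt (((X : ℂ[X]) ^ r) ⊗ₜ[ℂ] τ u) := by
  obtain _ | r := r
  · rintro u (rfl : u = 0)
    simp
  induction r with
  | zero =>
    rintro _ ⟨x, rfl⟩
    rw [TensorAlgebra.lift_ι_apply, hτ.1, zero_add, pow_one, hη]
  | succ r ih =>
    intro u hu
    refine Fr_succ_succ_le (S := LinearMap.eqLocus (TensorAlgebra.lift ℂ η).toLinearMap
      (ρt ∘ₗ TensorProduct.mk ℂ ℂ[X] a (X ^ (r + 2)) ∘ₗ τ)) (fun x y hy => ?_) hu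
    have h := hτ.2 1 (r + 1) _ (ι_mem_Fr_one x) y hy
    rw [LinearMap.mem_eqLocus, LinearMap.comp_apply, LinearMap.comp_apply, h, hτ.1]
    simp only [AlgHom.toLinearMap_apply, map_sub, map_mul, TensorAlgebra.lift_ι_apply,
      TensorProduct.mk_apply]
    rw [ih y hy, hη, ← Ring.lie_def, ← hρt, LieAlgebra.ExtendScalars.bracket_tmul, ← pow_succ']

/-- A module homomorphism `η` with `ker τ[t] ⊆ ker η_T` determines a representation of `a[t]`. -/
theorem exists_current_rep (h𝔞 : Submodule.span ℂ {z : a | ∃ x y : a, z = ⁅x, y⁆} = ⊤)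
    {τ : TensorAlgebra ℂ a →ₗ[ℂ] a} (hτ : IsTau a τ)
    {τt : TensorAlgebra ℂ a →ₗ[ℂ] Cur a} (hτt : IsTauT a τ τt)
    (ρ : a →ₗ[ℂ] Module.End ℂ V) (hρ : ∀ x y : a, ρ ⁅x, y⁆ = ⁅ρ x, ρ y⁆)
    (η : a →ₗ[ℂ] Module.End ℂ V) (hη : ∀ x y : a, η ⁅x, y⁆ = ⁅ρ x, η y⁆)
    (hker : ∀ u ∈ FLie a, τt u = 0 → TensorAlgebra.lift ℂ η u = 0) :
    ∃ ρt : Cur a →ₗ[ℂ] Module.End ℂ V,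
      (∀ z w : Cur a, ρt ⁅z, w⁆ = ⁅ρt z, ρt w⁆) ∧
      (∀ x : a, ρt ((1 : ℂ[X]) ⊗ₜ[ℂ] x) = ρ x) ∧
      (∀ r : ℕ, ∀ u ∈ Fr a r,
        ρt (((X : ℂ[X]) ^ r) ⊗ₜ[ℂ] (τ u)) = TensorAlgebra.lift ℂ η u) := by
  have hfac (r : ℕ) : ∃ f : a →ₗ[ℂ] Module.End ℂ V,
      ∀ u ∈ Fr a (r + 1), f (τ u) = TensorAlgebra.lift ℂ η u :=
    hτ.exists_factor h𝔞 r (TensorAlgebra.lift ℂ η).toLinearMap fun u hu h0 =>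
      hker u (le_iSup (Fr a) (r + 1) hu) (by rw [hτt _ u hu, h0, TensorProduct.tmul_zero])
  choose f hf using hfac
  have hf0 (x : a) : f 0 x = η x := by
    simpa [hτ.1] using hf 0 _ (ι_mem_Fr_one x)
  have hlie (r s : ℕ) (x y : a) : f (r + s + 1) ⁅x, y⁆ = ⁅f r x, f s y⁆ := by
    obtain ⟨u, hu, rfl⟩ := hτ.exists_mem_Fr h𝔞 r x
    obtain ⟨v, hv, rfl⟩ := hτ.exists_mem_Fr h𝔞 s y
    rw [← hτ.2 _ _ u hu v hv, hf _ _ (commutator_mem_Fr r s u hu v hv), hf _ u hu, hf _ v hv,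
      map_sub, map_mul, map_mul, Ring.lie_def]
  have hmod (s : ℕ) (x y : a) : f s ⁅x, y⁆ = ⁅ρ x, f s y⁆ := by
    induction s generalizing x y with
    | zero => rw [hf0, hf0, hη]
    | succ s ih =>
      have hy : y ∈ Submodule.span ℂ {z : a | ∃ x y : a, z = ⁅x, y⁆} := h𝔞 ▸ Submodule.mem_top
      induction hy using Submodule.span_induction with
      | mem y hy =>
        obtain ⟨p, q, rfl⟩ := hy
        have h (p q : a) : f (s + 1) ⁅p, q⁆ = ⁅η p, f s q⁆ := by
          rw [← hf0, ← hlie, zero_add]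
        rw [leibniz_lie, map_add, h, h, h, hη, ih]
        simp only [Ring.lie_def]
        noncomm_ring
      | zero => simp [Ring.lie_def]
      | add y z _ _ hy hz =>
        rw [lie_add, map_add, hy, hz, map_add]
        simp only [Ring.lie_def]
        noncomm_ring
      | smul c y _ hy =>
        rw [lie_smul, map_smul, hy, map_smul]
        simp only [Ring.lie_def, mul_smul_comm, smul_mul_assoc, smul_sub]
  obtain ⟨ρt, hρt⟩ := Cur.exists_linearMap (fun r => Nat.casesOn r ρ f : ℕ → a →ₗ[ℂ] _)
  refine ⟨ρt, Cur.map_lie ρt fun r s x y => ?_, fun x => by simpa using hρt 0 x,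
    fun r u hu => ?_⟩
  · rw [hρt, hρt, hρt]
    obtain _ | r := r
    · obtain _ | s := s
      · exact hρ x y
      · rw [zero_add]
        exact hmod s x y
    · obtain _ | s := s
      · change f r ⁅x, y⁆ = ⁅f r x, ρ y⁆
        rw [← lie_skew, map_neg, hmod, Ring.lie_def, Ring.lie_def, neg_sub]
      · rw [show r + 1 + (s + 1) = r + s + 1 + 1 by ring]
        exact hlie r s x y
  · obtain _ | r := r
    · obtain rfl : u = 0 := hu
      simp
    · rw [hρt]
      exact hf r u hu

end FreeLie

/-- Let `ρ : a → End V` be a Lie algebra homomorphism.  There is a Lie algebra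
homomorphism `ρ[t] : a[t] → End V` with `ρ[t](x ⊗ 1) = ρ(x)` if and only if there is a linear
map `η : a → End V` which is a homomorphism of `a`-modules (`η⁅x,y⁆ = ⁅ρ(x), η(y)⁆`) with
`ker τ[t] ⊆ ker η_T`.  Moreover, in that case the action is given on `a ⊗ t^r` by
`ρ[t](τ(𝐱) ⊗ t^r) = η^{⊙r}(𝐱)` for `𝐱 ∈ F^r(a)`. -/
theorem statement5 (a : Type*) [LieRing a] [LieAlgebra ℂ a]
    (h𝔞 : Submodule.span ℂ {z : a | ∃ x y : a, z = ⁅x, y⁆} = ⊤)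
    (V : Type*) [AddCommGroup V] [Module ℂ V]
    (τ : TensorAlgebra ℂ a →ₗ[ℂ] a) (hτ : IsTau a τ)
    (τt : TensorAlgebra ℂ a →ₗ[ℂ] Cur a) (hτt : IsTauT a τ τt)
    (ρ : a →ₗ[ℂ] Module.End ℂ V) (hρ : ∀ x y : a, ρ ⁅x, y⁆ = ⁅ρ x, ρ y⁆) :
    ((∃ ρt : Cur a →ₗ[ℂ] Module.End ℂ V,
        (∀ z w : Cur a, ρt ⁅z, w⁆ = ⁅ρt z, ρt w⁆) ∧
        (∀ x : a, ρt ((1 : ℂ[X]) ⊗ₜ[ℂ] x) = ρ x)) ↔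
      (∃ η : a →ₗ[ℂ] Module.End ℂ V,
        (∀ x y : a, η ⁅x, y⁆ = ⁅ρ x, η y⁆) ∧
        (∀ u ∈ FLie a, τt u = 0 → TensorAlgebra.lift ℂ η u = 0))) ∧
    (∀ η : a →ₗ[ℂ] Module.End ℂ V,
      (∀ x y : a, η ⁅x, y⁆ = ⁅ρ x, η y⁆) →
      (∀ u ∈ FLie a, τt u = 0 → TensorAlgebra.lift ℂ η u = 0) →
      ∃ ρt : Cur a →ₗ[ℂ] Module.End ℂ V,
        (∀ z w : Cur a, ρt ⁅z, w⁆ = ⁅ρt z, ρt w⁆) ∧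
        (∀ x : a, ρt ((1 : ℂ[X]) ⊗ₜ[ℂ] x) = ρ x) ∧
        (∀ r : ℕ, ∀ u ∈ Fr a r,
          ρt (((X : ℂ[X]) ^ r) ⊗ₜ[ℂ] (τ u)) = TensorAlgebra.lift ℂ η u)) := by
  refine ⟨⟨?_, ?_⟩, fun η hη hker => exists_current_rep h𝔞 hτ hτt ρ hρ η hη hker⟩
  · rintro ⟨ρt, hρt, hρt1⟩
    let η : a →ₗ[ℂ] Module.End ℂ V := ρt ∘ₗ TensorProduct.mk ℂ ℂ[X] a X
    refine ⟨η, fun x y => ?_, fun u hu h0 => ?_⟩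
    · change ρt _ = ⁅ρ x, ρt _⁆
      rw [← hρt1, ← hρt, TensorProduct.mk_apply, TensorProduct.mk_apply,
        LieAlgebra.ExtendScalars.bracket_tmul, one_mul]
    · have hle : FLie a ≤ LinearMap.eqLocus (TensorAlgebra.lift ℂ η).toLinearMap (ρt ∘ₗ τt) :=
        iSup_le fun r v hv => by
          rw [LinearMap.mem_eqLocus, LinearMap.comp_apply, hτt r v hv]
          exact lift_eq_of_mem_Fr hτ ρt hρt η (fun _ => rfl) r v hv
      have h := hle hu
      rw [LinearMap.mem_eqLocus, LinearMap.comp_apply, h0, map_zero] at h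
      exact h
  · rintro ⟨η, hη, hker⟩
    obtain ⟨ρt, h, h1, -⟩ := exists_current_rep h𝔞 hτ hτt ρ hρ η hη hker
    exact ⟨ρt, h, h1⟩
end
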